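/- (Muchnik–Pak) Let G be a group with a finite semigroup-generating set S and positive weight π. Let d ≥ 2 be an integer, K a nonempty finite set, η ∈ (0,1), and c₀ > 0. Assume there is an injective map Φ : G → K × G^d such that for every ℓ ≥ 0 and every g with ‖g‖_{S,π} ≤ ℓ, writing Φ(g) = (k, g₁, …, g_d), one has Σᵢ ‖gᵢ‖_{S,π} ≤ η·ℓ + c₀. Then there is a constant c > 0 such that γ_{G,S,π}(ℓ) ≤ exp(c·ℓ^α) for all ℓ ≥ 0, where α = log(d) / (log(d) − log(η)). -/

import Mathlib

/-- The `π`-length of a word `w` over the group `G`: the sum of the weights of its letters. -/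
noncomputable def wlen {G : Type*} (π : G → ℝ) (w : List G) : ℝ := (w.map π).sum

/-- The weighted word norm of `g` with respect to the generating set `S` and weight `π`:
the infimum of the `π`-lengths of words over `S` evaluating to `g`. -/
noncomputable def wnorm {G : Type*} [Group G] (S : Set G) (π : G → ℝ) (g : G) : ℝ :=
  sInf {r : ℝ | ∃ w : List G, (∀ x ∈ w, x ∈ S) ∧ w.prod = g ∧ wlen π w = r}

/-- The growth function `γ_{G,S,π}(ℓ)`: the cardinality of the ball of radius `ℓ`. -/
noncomputable def growth {G : Type*} [Group G] (S : Set G) (π : G → ℝ) (ℓ : ℝ) : ℕ :=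
  Nat.card {g : G | wnorm S π g ≤ ℓ}

open scoped ENNReal

section WordNorm

variable {G : Type*} {S : Set G} {π : G → ℝ}

theorem exists_pos_le_weight (hS : S.Finite) (hπ : ∀ s ∈ S, 0 < π s) :
    ∃ m : ℝ, 0 < m ∧ ∀ s ∈ S, m ≤ π s := by
  rcases S.eq_empty_or_nonempty with rfl | hne
  · exact ⟨1, one_pos, by simp⟩
  · obtain ⟨a, ha, hmin⟩ := Set.exists_min_image S π hS hne
    exact ⟨π a, hπ a ha, hmin⟩

theorem wlen_nonneg (hπ : ∀ s ∈ S, 0 < π s) {w : List G} (hw : ∀ x ∈ w, x ∈ S) :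
    0 ≤ wlen π w := by
  refine List.sum_nonneg fun r hr => ?_
  obtain ⟨x, hx, rfl⟩ := List.mem_map.1 hr
  exact (hπ x (hw x hx)).le

theorem mul_length_le_wlen {m : ℝ} (hm : ∀ s ∈ S, m ≤ π s) {w : List G}
    (hw : ∀ x ∈ w, x ∈ S) : m * w.length ≤ wlen π w := by
  have h := List.card_nsmul_le_sum (w.map π) m fun r hr => by
    obtain ⟨x, hx, rfl⟩ := List.mem_map.1 hr
    exact hm x (hw x hx)
  simpa [wlen, mul_comm] using h

variable [Group G]

theorem wnorm_nonneg (hπ : ∀ s ∈ S, 0 < π s) (g : G) : 0 ≤ wnorm S π g := by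
  refine Real.sInf_nonneg ?_
  rintro r ⟨w, hw, -, rfl⟩
  exact wlen_nonneg hπ hw

theorem exists_word_wlen_lt (hgen : ∀ g : G, ∃ w : List G, (∀ x ∈ w, x ∈ S) ∧ w.prod = g)
    {g : G} {r : ℝ} (hr : wnorm S π g < r) :
    ∃ w : List G, (∀ x ∈ w, x ∈ S) ∧ w.prod = g ∧ wlen π w < r := by
  obtain ⟨w₀, hw₀, hg⟩ := hgen g
  rw [wnorm] at hr
  obtain ⟨_, ⟨w, hw, hwg, rfl⟩, hlt⟩ :=
    exists_lt_of_csInf_lt (by exact ⟨_, w₀, hw₀, hg, rfl⟩) hr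
  exact ⟨w, hw, hwg, hlt⟩

theorem eq_one_of_wnorm_lt (hgen : ∀ g : G, ∃ w : List G, (∀ x ∈ w, x ∈ S) ∧ w.prod = g)
    {m : ℝ} (hm0 : 0 < m) (hm : ∀ s ∈ S, m ≤ π s) {g : G} (hg : wnorm S π g < m) : g = 1 := by
  obtain ⟨w, hw, rfl, hlt⟩ := exists_word_wlen_lt hgen hg
  have h := (mul_length_le_wlen hm hw).trans_lt hlt
  have h1 : (w.length : ℝ) < 1 := by nlinarith
  have h0 : w.length = 0 := by
    have : w.length < 1 := by exact_mod_cast h1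
    omega
  simp [List.length_eq_zero_iff.1 h0]

theorem growth_le_one (hgen : ∀ g : G, ∃ w : List G, (∀ x ∈ w, x ∈ S) ∧ w.prod = g)
    {m : ℝ} (hm0 : 0 < m) (hm : ∀ s ∈ S, m ≤ π s) {l : ℝ} (hl : l < m) :
    growth S π l ≤ 1 := by
  have : Subsingleton {g : G | wnorm S π g ≤ l} := ⟨fun a b => Subtype.ext <| by
    rw [eq_one_of_wnorm_lt hgen hm0 hm (a.2.trans_lt hl),
      eq_one_of_wnorm_lt hgen hm0 hm (b.2.trans_lt hl)]⟩
  exact Finite.card_le_one_iff_subsingleton.2 this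

end WordNorm

theorem ENNReal.tsum_pi_fin_prod {α : Type*} (u : α → ℝ≥0∞) (d : ℕ) :
    ∑' f : Fin d → α, ∏ i, u (f i) = (∑' a, u a) ^ d := by
  induction d with
  | zero => simp
  | succ d ih =>
    rw [← (Fin.consEquiv fun _ => α).tsum_eq, ENNReal.tsum_prod']
    simp [Fin.consEquiv, Fin.prod_univ_succ, ENNReal.tsum_mul_left, ENNReal.tsum_mul_right, ih,
      pow_succ']

theorem ENNReal.tsum_list_pow_length {α : Type*} [Fintype α] (x : ℝ≥0∞) :
    ∑' w : List α, x ^ w.length = (1 - Fintype.card α * x)⁻¹ := by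
  rw [← List.equivSigmaTuple.symm.tsum_eq, ENNReal.tsum_sigma', ← ENNReal.tsum_geometric]
  refine tsum_congr fun n => ?_
  simp [List.equivSigmaTuple, mul_pow]

/-- The exponential growth series `∑ exp (-s ‖g‖)` of `G`. -/
noncomputable def growthSeries {G : Type*} [Group G] (S : Set G) (π : G → ℝ) (s : ℝ) : ℝ≥0∞ :=
  ∑' g : G, ENNReal.ofReal (Real.exp (-(s * wnorm S π g)))

section GrowthSeries

variable {G : Type*} [Group G] {S : Set G} {π : G → ℝ}

theorem exists_growthSeries_ne_top (hS : S.Finite) (hπ : ∀ s ∈ S, 0 < π s)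
    (hgen : ∀ g : G, ∃ w : List G, (∀ x ∈ w, x ∈ S) ∧ w.prod = g) :
    ∃ s : ℝ, 0 < s ∧ growthSeries S π s ≠ ∞ := by
  obtain ⟨m, hm0, hm⟩ := exists_pos_le_weight hS hπ
  have := hS.fintype
  set N : ℝ := (Fintype.card S : ℝ)
  have hN : 0 ≤ N := Nat.cast_nonneg _
  set s : ℝ := (N + 1) / m
  have hs : 0 < s := by positivity
  refine ⟨s, hs, ?_⟩
  have hex (g : G) : ∃ w : List S, (w.map Subtype.val).prod = g ∧
      wlen π (w.map Subtype.val) < wnorm S π g + 1 := by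
    obtain ⟨w, hw, hg, hlt⟩ := exists_word_wlen_lt (π := π) hgen (lt_add_one (wnorm S π g))
    lift w to List S using hw
    exact ⟨w, hg, hlt⟩
  choose w hw hlt using hex
  have hinj : Function.Injective w := fun a b h => by rw [← hw a, ← hw b, h]
  set x : ℝ≥0∞ := ENNReal.ofReal (Real.exp (-(s * m)))
  have hterm (g : G) : ENNReal.ofReal (Real.exp (-(s * wnorm S π g))) ≤
      ENNReal.ofReal (Real.exp s) * x ^ (w g).length := by
    rw [← ENNReal.ofReal_pow (Real.exp_pos _).le, ← ENNReal.ofReal_mul (Real.exp_pos _).le,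
      ← Real.exp_nat_mul, ← Real.exp_add]
    refine ENNReal.ofReal_le_ofReal (Real.exp_le_exp.2 ?_)
    have h := mul_length_le_wlen (π := π) hm (w := (w g).map Subtype.val)
      (by simp +contextual)
    rw [List.length_map] at h
    nlinarith [hlt g]
  have hx : (Fintype.card S : ℝ≥0∞) * x < 1 := by
    have hsm : s * m = N + 1 := div_mul_cancel₀ _ hm0.ne'
    rw [← ENNReal.ofReal_natCast, ← ENNReal.ofReal_mul (Nat.cast_nonneg _), ENNReal.ofReal_lt_one,
      hsm, Real.exp_neg, ← div_eq_mul_inv, div_lt_one (Real.exp_pos _)]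
    have := Real.add_one_le_exp (N + 1)
    change N < _
    linarith
  refine ne_top_of_le_ne_top ?_ ((ENNReal.tsum_le_tsum hterm).trans
    (ENNReal.tsum_comp_le_tsum_of_injective hinj
      fun v => ENNReal.ofReal (Real.exp s) * x ^ v.length))
  rw [ENNReal.tsum_mul_left, ENNReal.tsum_list_pow_length]
  exact ENNReal.mul_ne_top ENNReal.ofReal_ne_top (ENNReal.inv_ne_top.2 (tsub_pos_of_lt hx).ne')

theorem growth_le_of_growthSeries_le {s l A : ℝ} (hs : 0 ≤ s)
    (h : growthSeries S π s ≤ ENNReal.ofReal (Real.exp A)) :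
    (growth S π l : ℝ) ≤ Real.exp (A + s * l) := by
  have hle : (growth S π l : ℝ≥0∞) * ENNReal.ofReal (Real.exp (-(s * l))) ≤
      ENNReal.ofReal (Real.exp A) := by
    calc (growth S π l : ℝ≥0∞) * ENNReal.ofReal (Real.exp (-(s * l)))
        ≤ ∑' _ : {g : G | wnorm S π g ≤ l}, ENNReal.ofReal (Real.exp (-(s * l))) := by
          rw [ENNReal.tsum_const]
          gcongr
          rcases finite_or_infinite {g : G | wnorm S π g ≤ l} with hf | hf
          · rw [growth, ENat.card_eq_coe_natCard, ENat.toENNReal_coe]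
          · simp [growth]
      _ ≤ ∑' g : {g : G | wnorm S π g ≤ l},
            ENNReal.ofReal (Real.exp (-(s * wnorm S π (g : G)))) := by
          refine ENNReal.tsum_le_tsum fun g => ENNReal.ofReal_le_ofReal (Real.exp_le_exp.2 ?_)
          exact neg_le_neg (mul_le_mul_of_nonneg_left g.2 hs)
      _ ≤ growthSeries S π s := ENNReal.tsum_comp_le_tsum_of_injective Subtype.val_injective _
      _ ≤ _ := h
  rw [← ENNReal.ofReal_natCast, ← ENNReal.ofReal_mul (Nat.cast_nonneg _),
    ENNReal.ofReal_le_ofReal_iff (Real.exp_pos _).le, Real.exp_neg, ← div_eq_mul_inv,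
    div_le_iff₀ (Real.exp_pos _), ← Real.exp_add] at hle
  exact hle

/-- The contracting embedding yields a functional inequality for the growth series. -/
theorem growthSeries_contraction (hπ : ∀ s ∈ S, 0 < π s) {d : ℕ} {K : Type*} [Fintype K]
    {η c₀ : ℝ} {Φ : G → K × (Fin d → G)} (hΦinj : Function.Injective Φ)
    (hΦ : ∀ ℓ : ℝ, 0 ≤ ℓ → ∀ g : G, wnorm S π g ≤ ℓ →
      ∑ i : Fin d, wnorm S π ((Φ g).2 i) ≤ η * ℓ + c₀) {s : ℝ} (hs : 0 ≤ s) :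
    growthSeries S π (η * s) ≤
      ENNReal.ofReal (Fintype.card K * Real.exp (s * c₀)) * growthSeries S π s ^ d := by
  set u : G → ℝ≥0∞ := fun g => ENNReal.ofReal (Real.exp (-(s * wnorm S π g)))
  have hterm (g : G) : ENNReal.ofReal (Real.exp (-(η * s * wnorm S π g))) ≤
      ENNReal.ofReal (Real.exp (s * c₀)) * ∏ i, u ((Φ g).2 i) := by
    simp only [u]
    rw [← ENNReal.ofReal_prod_of_nonneg fun _ _ => (Real.exp_pos _).le, ← Real.exp_sum,
      ← ENNReal.ofReal_mul (Real.exp_pos _).le, ← Real.exp_add]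
    refine ENNReal.ofReal_le_ofReal (Real.exp_le_exp.2 ?_)
    rw [Finset.sum_neg_distrib, ← Finset.mul_sum]
    nlinarith [mul_le_mul_of_nonneg_left (hΦ _ (wnorm_nonneg hπ g) g le_rfl) hs]
  refine ((ENNReal.tsum_le_tsum hterm).trans (ENNReal.tsum_comp_le_tsum_of_injective hΦinj
    fun p => ENNReal.ofReal (Real.exp (s * c₀)) * ∏ i, u (p.2 i))).trans_eq ?_
  rw [ENNReal.tsum_mul_left, ENNReal.tsum_prod', ENNReal.ofReal_mul (Nat.cast_nonneg _)]
  simp only [ENNReal.tsum_pi_fin_prod, tsum_fintype, Finset.sum_const, Finset.card_univ,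
    nsmul_eq_mul, ENNReal.ofReal_natCast]
  rw [mul_left_comm, mul_assoc]
  rfl

theorem exists_growthSeries_le (hS : S.Finite) (hπ : ∀ s ∈ S, 0 < π s)
    (hgen : ∀ g : G, ∃ w : List G, (∀ x ∈ w, x ∈ S) ∧ w.prod = g)
    {d : ℕ} (hd : 2 ≤ d) {K : Type*} [Fintype K] {η c₀ : ℝ} (hη : η ∈ Set.Ioo (0 : ℝ) 1)
    (hc₀ : 0 < c₀) {Φ : G → K × (Fin d → G)} (hΦinj : Function.Injective Φ)
    (hΦ : ∀ ℓ : ℝ, 0 ≤ ℓ → ∀ g : G, wnorm S π g ≤ ℓ →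
      ∑ i : Fin d, wnorm S π ((Φ g).2 i) ≤ η * ℓ + c₀) :
    ∃ s A : ℝ, 0 < s ∧ 0 < A ∧
      ∀ n : ℕ, growthSeries S π (η ^ n * s) ≤ ENNReal.ofReal (Real.exp (A * d ^ n)) := by
  obtain ⟨s, hs, hfin⟩ := exists_growthSeries_ne_top hS hπ hgen
  set κ : ℝ := Fintype.card K + s * c₀
  have hκ : 0 ≤ κ := by positivity
  set A : ℝ := (growthSeries S π s).toReal + 1 + κ
  have hA : 0 < A := by positivity
  have hd' : (2 : ℝ) ≤ d := by exact_mod_cast hd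
  have key (n : ℕ) :
      growthSeries S π (η ^ n * s) ≤ ENNReal.ofReal (Real.exp (A * d ^ n - κ)) := by
    induction n with
    | zero =>
      rw [pow_zero, one_mul, pow_zero, mul_one, ← ENNReal.ofReal_toReal hfin]
      refine ENNReal.ofReal_le_ofReal ?_
      have := Real.add_one_le_exp (A - κ)
      simp only [A] at this ⊢
      linarith
    | succ n ih =>
      have hsn : 0 ≤ η ^ n * s := mul_nonneg (pow_nonneg hη.1.le n) hs.le
      have hsle : η ^ n * s ≤ s := mul_le_of_le_one_left hs.le (pow_le_one₀ hη.1.le hη.2.le)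
      have hK : Fintype.card K * Real.exp (η ^ n * s * c₀) ≤ Real.exp κ := by
        rw [Real.exp_add]
        gcongr
        linarith [Real.add_one_le_exp (Fintype.card K : ℝ)]
      rw [pow_succ', mul_assoc]
      calc _ ≤ _ := growthSeries_contraction hπ hΦinj hΦ hsn
        _ ≤ ENNReal.ofReal (Real.exp κ) * ENNReal.ofReal (Real.exp (A * d ^ n - κ)) ^ d := by
          gcongr
        _ ≤ _ := by
          rw [← ENNReal.ofReal_pow (Real.exp_pos _).le, ← ENNReal.ofReal_mul (Real.exp_pos _).le,
            ← Real.exp_nat_mul, ← Real.exp_add]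
          refine ENNReal.ofReal_le_ofReal (Real.exp_le_exp.2 ?_)
          rw [pow_succ]
          nlinarith
  exact ⟨s, A, hs, hA, fun n => (key n).trans
    (ENNReal.ofReal_le_ofReal (Real.exp_le_exp.2 (by linarith)))⟩

end GrowthSeries

/-- Balancing the increasing sequence `D ^ n` against the decreasing sequence `η ^ n * l`. -/
theorem exists_pow_le_rpow {D η l : ℝ} (hD : 1 < D) (hη : η ∈ Set.Ioo (0 : ℝ) 1) (hl : 1 ≤ l) :
    ∃ n : ℕ, D ^ n ≤ l ^ (Real.log D / (Real.log D - Real.log η)) ∧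
      η ^ n * l ≤ η⁻¹ * l ^ (Real.log D / (Real.log D - Real.log η)) := by
  have hlogD : 0 < Real.log D := Real.log_pos hD
  have hlogη : Real.log η < 0 := Real.log_neg hη.1 hη.2
  have hden : 0 < Real.log D - Real.log η := by linarith
  have hlogl : 0 ≤ Real.log l := Real.log_nonneg hl
  have hl0 : 0 < l := by linarith
  set t : ℝ := Real.log l / (Real.log D - Real.log η)
  have ht : t * (Real.log D - Real.log η) = Real.log l := div_mul_cancel₀ _ hden.ne'
  have ht0 : 0 ≤ t := div_nonneg hlogl hden.le
  have hpow : l ^ (Real.log D / (Real.log D - Real.log η)) = Real.exp (t * Real.log D) := by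
    rw [Real.rpow_def_of_pos hl0]
    congr 1
    simp only [t]
    ring
  refine ⟨⌊t⌋₊, ?_, ?_⟩
  · rw [hpow, ← Real.exp_log (pow_pos (one_pos.trans hD) _), Real.log_pow, Real.exp_le_exp]
    exact mul_le_mul_of_nonneg_right (Nat.floor_le ht0) hlogD.le
  · have hη' : η⁻¹ = Real.exp (-Real.log η) := by rw [Real.exp_neg, Real.exp_log hη.1]
    rw [hpow, hη', ← Real.exp_add, ← Real.exp_log (mul_pos (pow_pos hη.1 _) hl0),
      Real.log_mul (pow_pos hη.1 _).ne' hl0.ne', Real.log_pow, Real.exp_le_exp]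
    nlinarith [Nat.lt_floor_add_one t]

/-- Muchnik–Pak: a strong contraction embedding
`B(ℓ) ↪ ∪_{ℓ₁+⋯+ℓ_d ≤ ηℓ+c₀} K × ∏ᵢ B(ℓᵢ)` forces subexponential growth
`γ(ℓ) ≤ exp(c·ℓ^α)` with `α = log d / (log d − log η)`. -/
theorem muchnik_pak {G : Type*} [Group G] (S : Set G) (π : G → ℝ)
    (hSfin : S.Finite) (hone : (1 : G) ∉ S)
    (hgen : ∀ g : G, ∃ w : List G, (∀ x ∈ w, x ∈ S) ∧ w.prod = g)
    (hπ : ∀ s ∈ S, 0 < π s)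
    (d : ℕ) (hd : 2 ≤ d)
    (K : Type*) [Fintype K] [Nonempty K]
    (η : ℝ) (hη : η ∈ Set.Ioo (0 : ℝ) 1) (c₀ : ℝ) (hc₀ : 0 < c₀)
    (Φ : G → K × (Fin d → G)) (hΦinj : Function.Injective Φ)
    (hΦ : ∀ ℓ : ℝ, 0 ≤ ℓ → ∀ g : G, wnorm S π g ≤ ℓ →
      ∑ i : Fin d, wnorm S π ((Φ g).2 i) ≤ η * ℓ + c₀) :
    ∃ c : ℝ, 0 < c ∧ ∀ ℓ : ℝ, 0 ≤ ℓ →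
      (growth S π ℓ : ℝ) ≤
        Real.exp (c * ℓ ^ (Real.log d / (Real.log d - Real.log η))) := by
  obtain ⟨s, A, hs, hA, hF⟩ := exists_growthSeries_le hSfin hπ hgen hd hη hc₀ hΦinj hΦ
  obtain ⟨m, hm0, hm⟩ := exists_pos_le_weight hSfin hπ
  have hd' : (1 : ℝ) < d := by exact_mod_cast hd
  have hη0 := hη.1
  set α : ℝ := Real.log d / (Real.log d - Real.log η)
  have hα : 0 ≤ α := div_nonneg (Real.log_pos hd').le
    (by linarith [Real.log_pos hd', Real.log_neg hη.1 hη.2])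
  set M : ℝ := max 1 m⁻¹
  have hM : 0 < M := one_pos.trans_le (le_max_left _ _)
  have hC : 0 < A + s * η⁻¹ := by positivity
  refine ⟨(A + s * η⁻¹) * M ^ α, by positivity, fun l hl => ?_⟩
  rcases lt_or_ge l m with hlm | hml
  · calc (growth S π l : ℝ) ≤ 1 := by exact_mod_cast growth_le_one hgen hm0 hm hlm
      _ ≤ _ := Real.one_le_exp (by positivity)
  · have hMl : 1 ≤ M * l := by
      calc (1 : ℝ) = m⁻¹ * m := (inv_mul_cancel₀ hm0.ne').symm
        _ ≤ M * l := by gcongr; exact le_max_right _ _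
    have hle : l ≤ M * l := le_mul_of_one_le_left hl (le_max_left _ _)
    obtain ⟨n, hn₁, hn₂⟩ := exists_pow_le_rpow hd' hη hMl
    refine (growth_le_of_growthSeries_le (by positivity) (hF n)).trans (Real.exp_le_exp.2 ?_)
    rw [mul_assoc _ (M ^ α), ← Real.mul_rpow hM.le hl]
    have h₁ := mul_le_mul_of_nonneg_left hn₁ hA.le
    have h₂ := mul_le_mul_of_nonneg_left
      ((mul_le_mul_of_nonneg_left hle (pow_nonneg hη0.le n)).trans hn₂) hs.le
    linarith
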